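/- arXiv:1409.0404 — 2 statements merged into one kernel-verified Lean document; each statement's English description precedes it below -/
import Mathlib

section
/- Let V be a finite-dimensional real vector space, ω an alternating (skew-symmetric) bilinear form on V, and W ⊆ V a linear subspace. Then dim W + dim W^ω = dim V + dim (V^ω ∩ W), where for a subspace U ⊆ V its ω-complement is U^ω = {v ∈ V : ω(v,u) = 0 for all u ∈ U}. -/
open FiniteDimensional Module

/-- The presymplectic complement `U^ω = {v ∈ V : ω(v,u) = 0 for all u ∈ U}`. -/
def presymplecticComplement {V : Type*} [AddCommGroup V] [Module ℝ V]
    (ω : V →ₗ[ℝ] V →ₗ[ℝ] ℝ) (U : Submodule ℝ V) : Submodule ℝ V where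
  carrier := {v | ∀ u ∈ U, ω v u = 0}
  add_mem' := by
    intro a b ha hb u hu
    simp [map_add, LinearMap.add_apply, ha u hu, hb u hu]
  zero_mem' := by intro u hu; simp
  smul_mem' := by
    intro c a ha u hu
    simp [map_smul, LinearMap.smul_apply, ha u hu]

/-- For an alternating form the presymplectic complement is the orthogonal complement. -/
theorem presymplecticComplement_eq_orthogonal {V : Type*} [AddCommGroup V] [Module ℝ V]
    {ω : V →ₗ[ℝ] V →ₗ[ℝ] ℝ} (halt : ω.IsAlt) (U : Submodule ℝ V) :
    presymplecticComplement ω U = LinearMap.BilinForm.orthogonal ω U := by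
  ext v
  exact forall₂_congr fun u _ => halt.isRefl.eq_iff

/-- `dim W + dim W^ω = dim V + dim (V^ω ∩ W)`. -/
theorem dim_add_dim_presymplecticComplement
    {V : Type*} [AddCommGroup V] [Module ℝ V] [FiniteDimensional ℝ V]
    (ω : V →ₗ[ℝ] V →ₗ[ℝ] ℝ) (halt : ∀ v, ω v v = 0)
    (W : Submodule ℝ V) :
    finrank ℝ W + finrank ℝ (presymplecticComplement ω W) =
      finrank ℝ V +
        finrank ℝ (presymplecticComplement ω (⊤ : Submodule ℝ V) ⊓ W : Submodule ℝ V) := by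
  rw [presymplecticComplement_eq_orthogonal halt, presymplecticComplement_eq_orthogonal halt,
    inf_comm]
  exact LinearMap.BilinForm.finrank_add_finrank_orthogonal
    (LinearMap.IsAlt.isRefl halt) W
end

section
/- Let V be a finite-dimensional real vector space with an alternating bilinear form ω, let V′ ⊆ V be a coisotropic subspace of (V, ω), and let V″ ⊆ V′ be a coisotropic subspace of (V′, ω′), where ω′ is the restriction of ω to V′. Then V″ is a coisotropic subspace of (V, ω), i.e. (V″)^ω ⊆ V″. -/
/-- The double presymplectic complement of `U` lies in any subspace `W` containing both `U` and
its presymplectic complement. -/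
theorem presymplecticComplement_presymplecticComplement_le
    {V : Type*} [AddCommGroup V] [Module ℝ V] [FiniteDimensional ℝ V]
    {ω : V →ₗ[ℝ] V →ₗ[ℝ] ℝ} (hω : ω.IsAlt) {U W : Submodule ℝ V} (hUW : U ≤ W)
    (hcW : presymplecticComplement ω U ≤ W) :
    presymplecticComplement ω (presymplecticComplement ω U) ≤ W := by
  intro v hv
  have hmem : ω v ∈ U.map ω := by
    rw [← Subspace.dualCoannihilator_dualAnnihilator_eq (W := U.map ω),
      Submodule.mem_dualAnnihilator]
    intro x hx
    refine hv x fun u hu => hω.isRefl u x ?_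
    exact (Submodule.mem_dualCoannihilator _).1 hx (ω u) (Submodule.mem_map_of_mem hu)
  obtain ⟨w, hw, hwv⟩ := hmem
  have hker : v - w ∈ presymplecticComplement ω U := fun u _ => by simp [hwv]
  simpa using W.add_mem (hcW hker) (hUW hw)

/-- if `V′` is a coisotropic subspace of `(V,ω)` and `V″ ⊆ V′` is a
coisotropic subspace of `(V′, ω|_{V′})`, then `V″` is a coisotropic subspace of
`(V,ω)`. Coisotropicity of `V″` in `V′` means
`{v ∈ V′ : ω(v,u) = 0 for all u ∈ V″} ⊆ V″`. -/
theorem coisotropic_trans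
    {V : Type*} [AddCommGroup V] [Module ℝ V] [FiniteDimensional ℝ V]
    (ω : V →ₗ[ℝ] V →ₗ[ℝ] ℝ) (halt : ∀ v, ω v v = 0)
    (V' V'' : Submodule ℝ V) (hsub : V'' ≤ V')
    (hV'coiso : presymplecticComplement ω V' ≤ V')
    (hV''coiso : ∀ v ∈ V', (∀ u ∈ V'', ω v u = 0) → v ∈ V'') :
    presymplecticComplement ω V'' ≤ V'' := by
  have hcompl : presymplecticComplement ω V' ≤ V'' := fun v hv =>
    hV''coiso v (hV'coiso hv) fun u hu => hv u (hsub hu)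
  intro v hv
  refine hV''coiso v ?_ hv
  exact presymplecticComplement_presymplecticComplement_le halt le_rfl hV'coiso
    fun u hu => hv u (hcompl hu)
end
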